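/- Let τ be a correct compositional translation from SYNCSIMPLE to LOCKSIMPLE_{2,IS} of blocking type (P_1P_1, P_2P_2). Then: (1) the blocking prefix of τ(!) has the form R_1 P_1 {P_2,T_2}* T_2 P_1 and the blocking prefix of τ(?) has the form R_3 P_2 {P_1,T_1}* T_1 P_2; (2) τ(!) has a prefix in {T_1,P_1}* T_2 and τ(?) has a prefix in {T_2,P_2}* T_1. -/

import Mathlib

/-- Symbols of SYNCSIMPLE: `!` (bang) and `?` (ques). -/
inductive SSym | bang | ques
deriving DecidableEq

/-- A SYNCSIMPLE subprocess: a string over {!,?} ending with `0` (false) or `✓` (true). -/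
abbrev SSub := List SSym × Bool

/-- A SYNCSIMPLE process: a multiset of subprocesses. -/
abbrev SProc := Multiset SSub

/-- The SYS reduction: a leading `!` and a leading `?` of two subprocesses are consumed. -/
def SysStep (P Q : SProc) : Prop :=
  ∃ (u1 u2 : List SSym) (b1 b2 : Bool) (R : SProc),
    P = (SSym.bang :: u1, b1) ::ₘ (SSym.ques :: u2, b2) ::ₘ R ∧
    Q = (u1, b1) ::ₘ (u2, b2) ::ₘ R

/-- A process is successful if it contains the subprocess `✓`. -/
def SSuccessful (P : SProc) : Prop := (([], true) : SSub) ∈ P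

def SMayConv (P : SProc) : Prop :=
  ∃ Q, Relation.ReflTransGen SysStep P Q ∧ SSuccessful Q

def SMustConv (P : SProc) : Prop :=
  ∀ Q, Relation.ReflTransGen SysStep P Q → SMayConv Q

/-- Lock operations: put `P_i` and take `T_i`. -/
inductive LOp | put | take
deriving DecidableEq

abbrev LSym (k : ℕ) := LOp × Fin k
abbrev LSub (k : ℕ) := List (LSym k) × Bool
abbrev LProc (k : ℕ) := Multiset (LSub k)
/-- The store of `k` locks: `true` = full (■), `false` = empty (□). -/
abbrev Store (k : ℕ) := Fin k → Bool

/-- LOCKSIMPLE step: `P_i` fills an empty lock `i` (blocks if full);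
    `T_i` empties lock `i` and never blocks. -/
def LockStep {k : ℕ} : (LProc k × Store k) → (LProc k × Store k) → Prop :=
  fun s t => ∃ (i : Fin k) (u : List (LSym k)) (b : Bool) (R : LProc k),
    ((s.1 = ((LOp.put, i) :: u, b) ::ₘ R ∧ s.2 i = false ∧
      t.1 = (u, b) ::ₘ R ∧ t.2 = Function.update s.2 i true) ∨
     (s.1 = ((LOp.take, i) :: u, b) ::ₘ R ∧
      t.1 = (u, b) ::ₘ R ∧ t.2 = Function.update s.2 i false))

def LSuccessful {k : ℕ} (s : LProc k × Store k) : Prop := (([], true) : LSub k) ∈ s.1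

def LMayConv {k : ℕ} (s : LProc k × Store k) : Prop :=
  ∃ t, Relation.ReflTransGen LockStep s t ∧ LSuccessful t

def LMustConv {k : ℕ} (s : LProc k × Store k) : Prop :=
  ∀ t, Relation.ReflTransGen LockStep s t → LMayConv t

/-- The compositional translation determined by the strings `tb = τ(!)` and `tq = τ(?)`,
    applied to a subprocess. -/
def transSub {k : ℕ} (tb tq : List (LSym k)) (u : SSub) : LSub k :=
  (u.1.flatMap (fun c => match c with | SSym.bang => tb | SSym.ques => tq), u.2)

/-- The compositional translation applied to a process. -/
def transProc {k : ℕ} (tb tq : List (LSym k)) (P : SProc) : LProc k :=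
  P.map (transSub tb tq)

/-- Correctness of the compositional translation `(tb, tq)` with initial store `IS`:
    may- and must-convergence are preserved and reflected. -/
def Correct {k : ℕ} (IS : Store k) (tb tq : List (LSym k)) : Prop :=
  ∀ P : SProc,
    (SMayConv P ↔ LMayConv (transProc tb tq P, IS)) ∧
    (SMustConv P ↔ LMustConv (transProc tb tq P, IS))

/-- The solo execution of the string `s` from store `IS` reaches the point where
    `(put, i) :: rest` remains and deadlocks there since lock `i` is full. -/
def SoloBlocked {k : ℕ} (IS : Store k) (s : List (LSym k)) (i : Fin k)
    (rest : List (LSym k)) : Prop :=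
  ∃ C : Store k,
    Relation.ReflTransGen LockStep (({(s, false)} : LProc k), IS)
      (({((LOp.put, i) :: rest, false)} : LProc k), C) ∧
    C i = true

/-- Blocking type `P_i`: the blocking prefix is `R P_i` with `R` free of `P_i, T_i`. -/
def BlockingTypeP {k : ℕ} (IS : Store k) (s : List (LSym k)) (i : Fin k) : Prop :=
  ∃ r rest, s = r ++ (LOp.put, i) :: rest ∧ (∀ x ∈ r, x.2 ≠ i) ∧
    SoloBlocked IS s i rest

/-- Blocking type `P_i P_i`: the blocking prefix is `R₁ P_i R₂ P_i` with
    `R₂` free of `P_i, T_i`, deadlocking exactly before the last `P_i`. -/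
def BlockingTypePP {k : ℕ} (IS : Store k) (s : List (LSym k)) (i : Fin k) : Prop :=
  ∃ r1 r2 rest, s = r1 ++ (LOp.put, i) :: r2 ++ (LOp.put, i) :: rest ∧
    (∀ x ∈ r2, x.2 ≠ i) ∧ SoloBlocked IS s i rest

def en (C : Store 2) (a : LSym 2) : Prop := a.1 = LOp.put → C a.2 = false
def eff (C : Store 2) (a : LSym 2) : Store 2 := Function.update C a.2 (decide (a.1 = LOp.put))
def ok : Store 2 → List (LSym 2) → Prop
  | _, [] => True
  | C, a :: u => en C a ∧ ok (eff C a) u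
def fin (C : Store 2) (u : List (LSym 2)) : Store 2 := u.foldl eff C

abbrev Reach := @Relation.ReflTransGen (LProc 2 × Store 2) LockStep

theorem lockStep_iff (s t : LProc 2 × Store 2) : LockStep s t ↔
    ∃ a u b R, s.1 = (a :: u, b) ::ₘ R ∧ en s.2 a ∧ t.1 = (u, b) ::ₘ R ∧ t.2 = eff s.2 a := by
  constructor
  · rintro ⟨i, u, b, R, ⟨h1, h2, h3, h4⟩ | ⟨h1, h3, h4⟩⟩
    · exact ⟨(LOp.put, i), u, b, R, h1, fun _ => h2, h3, by simp [eff, h4]⟩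
    · exact ⟨(LOp.take, i), u, b, R, h1, by simp [en], h3, by simp [eff, h4]⟩
  · rintro ⟨⟨o, i⟩, u, b, R, h1, h2, h3, h4⟩
    refine ⟨i, u, b, R, ?_⟩
    cases o
    · left; exact ⟨h1, h2 rfl, h3, by simp [h4, eff]⟩
    · right; exact ⟨h1, h3, by simp [h4, eff]⟩

theorem step_ctx (C : Store 2) (a : LSym 2) (u b R) (h : en C a) :
    LockStep (((a :: u, b) ::ₘ R : LProc 2), C) (((u, b) ::ₘ R : LProc 2), eff C a) :=
  (lockStep_iff _ _).2 ⟨a, u, b, R, rfl, h, rfl, rfl⟩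

theorem run_ctx (u : List (LSym 2)) (w b R) : ∀ C : Store 2, ok C u →
    Reach (((u ++ w, b) ::ₘ R : LProc 2), C) (((w, b) ::ₘ R : LProc 2), fin C u) := by
  induction u with
  | nil => intro C _; exact .refl
  | cons a u ih =>
    intro C h
    exact .head (step_ctx C a (u ++ w) b R h.1) (ih _ h.2)

theorem ok_append (u w : List (LSym 2)) : ∀ C, ok C (u ++ w) ↔ ok C u ∧ ok (fin C u) w := by
  induction u with
  | nil => intro C; simp [ok, fin]
  | cons a u ih => intro C; simp [ok, ih, fin, and_assoc]

theorem fin_append (u w : List (LSym 2)) (C) : fin C (u ++ w) = fin (fin C u) w := by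
  simp [fin]

theorem solo (s : List (LSym 2)) (b : Bool) (C : Store 2) (x : LProc 2 × Store 2)
    (h : Reach (({(s, b)} : LProc 2), C) x) :
    ∃ u w, s = u ++ w ∧ x = (({(w, b)} : LProc 2), fin C u) ∧ ok C u := by
  induction h with
  | refl => exact ⟨[], s, rfl, rfl, trivial⟩
  | tail _ hs ih =>
    obtain ⟨u, w, rfl, rfl, hok⟩ := ih
    rename_i c _
    obtain ⟨a, v, b', R, h1, h2, h3, h4⟩ := (lockStep_iff _ _).1 hs
    have hm : (a :: v, b') ∈ ({(w, b)} : LProc 2) := by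
      have : (a :: v, b') ∈ (a :: v, b') ::ₘ R := Multiset.mem_cons_self _ _
      rw [← h1] at this; exact this
    obtain ⟨rfl, rfl⟩ := Prod.mk.inj (Multiset.mem_singleton.1 hm)
    have hR : R = 0 := by
      have h1' : (a :: v, b') ::ₘ (0 : LProc 2) = (a :: v, b') ::ₘ R := h1
      exact ((Multiset.cons_inj_right _).1 h1').symm
    refine ⟨u ++ [a], v, by simp, ?_, ?_⟩
    · apply Prod.ext
      · rw [h3, hR]; rfl
      · rw [h4, fin_append]; rfl
    · rw [ok_append]; exact ⟨hok, h2, trivial⟩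

theorem blocked_solo {IS : Store 2} {i : Fin 2} {u rest : List (LSym 2)}
    (h : SoloBlocked IS (u ++ (LOp.put, i) :: rest) i rest) :
    ok IS u ∧ fin IS u i = true := by
  obtain ⟨C, hr, hC⟩ := h
  obtain ⟨u', w, h1, h2, h3⟩ := solo _ _ _ _ hr
  obtain ⟨h4, h5⟩ := Prod.mk.inj h2
  have h6 := (Prod.mk.inj (Multiset.singleton_inj.1 h4)).1
  subst h6
  have := List.append_cancel_right h1
  subst this
  exact ⟨h3, h5 ▸ hC⟩

/-- the first operation on lock `j` exists and is a take -/
def ft (j : Fin 2) : List (LSym 2) → Prop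
  | [] => False
  | a :: u => if a.2 = j then a.1 = LOp.take else ft j u

/-- the first operation on lock `j`, if any, is a take -/
def nf (j : Fin 2) : List (LSym 2) → Prop
  | [] => True
  | a :: u => if a.2 = j then a.1 = LOp.take else nf j u

theorem ft_nf (j : Fin 2) (u w : List (LSym 2)) (h : ft j (u ++ w)) : nf j u := by
  induction u with
  | nil => trivial
  | cons a u ih =>
    simp only [List.cons_append, ft, nf] at *
    split_ifs at * <;> simp_all

theorem ft_ex (j : Fin 2) (s : List (LSym 2)) (h : ft j s) :
    ∃ pre rest, s = pre ++ (LOp.take, j) :: rest ∧ ∀ x ∈ pre, x.2 ≠ j := by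
  induction s with
  | nil => exact h.elim
  | cons a u ih =>
    simp only [ft] at h
    split_ifs at h with hj
    · exact ⟨[], u, by simp [← h, ← hj], by simp⟩
    · obtain ⟨pre, rest, rfl, hp⟩ := ih h
      refine ⟨a :: pre, rest, rfl, ?_⟩
      intro x hx
      rcases List.mem_cons.1 hx with rfl | hx
      · exact hj
      · exact hp x hx

def Blk (C : Store 2) (x : LSub 2) : Prop := ∃ i w, x.1 = (LOp.put, i) :: w ∧ C i = true

theorem dead_not_may (M : LProc 2) (C : Store 2) (h : ∀ x ∈ M, Blk C x) : ¬ LMayConv (M, C) := by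
  rintro ⟨t, hr, hs⟩
  rcases Relation.ReflTransGen.cases_head hr with rfl | ⟨c, hc, _⟩
  · obtain ⟨i, w, h1, _⟩ := h _ hs
    simp at h1
  · obtain ⟨a, v, b', R, h1, h2, h3, h4⟩ := (lockStep_iff _ _).1 hc
    obtain ⟨i, w, h5, h6⟩ := h (a :: v, b') (by simp only at h1; rw [h1]; simp)
    simp only [List.cons.injEq] at h5
    obtain ⟨rfl, _⟩ := h5
    have := h2 rfl
    simp_all

/-- part (2) -/
theorem part2 {IS : Store 2} {j : Fin 2} {s t : List (LSym 2)}
    (H : LMustConv ((t, true) ::ₘ Multiset.replicate 1 (s, false), IS))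
    (ht : BlockingTypePP IS t j) : ft j s := by
  by_contra hft
  obtain ⟨r3, r4, rest, ht1, -, hb⟩ := ht
  rw [ht1] at hb
  obtain ⟨h1, h2⟩ := blocked_solo hb
  have hrun := run_ctx _ ((LOp.put, j) :: rest) true (Multiset.replicate 1 (s, false)) IS h1
  rw [← ht1] at hrun
  obtain ⟨x, hx, hsx⟩ := H _ hrun
  have key : ∃ w D, x = ((w, false) ::ₘ {((LOp.put, j) :: rest, true)}, D) ∧ D j = true ∧ ¬ ft j w := by
    clear hsx
    induction hx with
    | refl => exact ⟨s, _, by rw [Multiset.replicate_one, ← Multiset.cons_zero, Multiset.cons_swap]; rfl, h2, hft⟩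
    | tail _ hs ih =>
      obtain ⟨w, D, rfl, hD, hw⟩ := ih
      obtain ⟨a, v, b', R, h1, h2, h3, h4⟩ := (lockStep_iff _ _).1 hs
      simp only at h1 h2 h4
      have hm : (a :: v, b') ∈ ((w, false) ::ₘ {((LOp.put, j) :: rest, true)} : LProc 2) := by
        rw [h1]; simp
      simp only [Multiset.mem_cons, Multiset.mem_singleton, Prod.mk.injEq, List.cons.injEq] at hm
      rcases hm with ⟨rfl, rfl⟩ | ⟨⟨rfl, _⟩, _⟩
      · have hR := (Multiset.cons_inj_right _).1 h1
        simp only [ft] at hw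
        refine ⟨v, eff D a, Prod.ext (by rw [h3, hR]) h4, ?_, ?_⟩
        · by_cases hj : a.2 = j
          · simp only [hj, if_true] at hw
            cases ha : a.1
            · simp [eff, hj, ha]
            · exact absurd ha hw
          · simp [eff, Function.update_of_ne (Ne.symm hj), hD]
        · by_cases hj : a.2 = j
          · simp only [hj, if_true] at hw
            cases ha : a.1
            · have := h2 ha
              rw [hj, hD] at this; cases this
            · exact absurd ha hw
          · simpa [hj] using hw
      · have := h2 rfl
        simp [hD] at this
  obtain ⟨w, D, rfl, _⟩ := key
  simp [LSuccessful] at hsx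

theorem eff_le (C D : Store 2) (a : LSym 2) (k : Fin 2) (h : C k ≤ D k) : eff C a k ≤ eff D a k := by
  by_cases hk : k = a.2
  · subst hk; simp [eff]
  · simpa [eff, Function.update_of_ne hk] using h

theorem fin_le (u : List (LSym 2)) (k : Fin 2) : ∀ C D : Store 2, C k ≤ D k → fin C u k ≤ fin D u k := by
  induction u with
  | nil => intro C D h; exact h
  | cons a u ih => intro C D h; exact ih _ _ (eff_le C D a k h)

theorem en_le (C D : Store 2) (a : LSym 2) (h : C a.2 ≤ D a.2) (hd : en D a) : en C a := by
  intro ha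
  have := hd ha
  rw [this] at h
  exact le_antisymm h (Bool.false_le _)

theorem ok_mono (u : List (LSym 2)) : ∀ C D : Store 2, C ≤ D → ok D u → ok C u := by
  induction u with
  | nil => intros; trivial
  | cons a u ih =>
    intro C D h hd
    exact ⟨en_le C D a (h _) hd.1, ih _ _ (fun k => eff_le C D a k (h k)) hd.2⟩

theorem ok_nf {i j : Fin 2} (hij : ∀ k, k ≠ j ↔ k = i) (u : List (LSym 2)) :
    ∀ C D : Store 2, C i ≤ D i → nf j u → ok D u → ok C u := by
  induction u with
  | nil => intros; trivial
  | cons a u ih =>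
    intro C D h hn hd
    by_cases hj : a.2 = j
    · simp only [nf, hj, if_true] at hn
      refine ⟨fun ha => by simp [hn] at ha, ok_mono u _ _ ?_ hd.2⟩
      intro k
      by_cases hk : k = j
      · simp [eff, hj, hk]
      · rw [(hij k).1 hk]; exact eff_le C D a i h
    · simp only [nf, hj, if_false] at hn
      have hi := (hij _).1 hj
      exact ⟨en_le C D a (by rw [hi]; exact h) hd.1, ih _ _ (eff_le C D a i h) hn hd.2⟩

theorem park {i j : Fin 2} (hij : ∀ k, k ≠ j ↔ k = i) (IS : Store 2) (r w : List (LSym 2))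
    (hn : nf j r) (hok : ok IS r) (hf : fin IS r i = false) (n : ℕ) :
    ∀ (C : Store 2) (R : LProc 2), C i ≤ IS i →
      ∃ C', Reach (Multiset.replicate n (r ++ w, false) + R, C)
        (Multiset.replicate n (w, false) + R, C') := by
  induction n with
  | zero => intro C R _; exact ⟨C, .refl⟩
  | succ n ih =>
    intro C R hC
    have h1 := run_ctx r w false (Multiset.replicate n (r ++ w, false) + R) C
      (ok_nf hij r C IS hC hn hok)
    have h2 : fin C r i ≤ IS i := by
      have := fin_le r i C IS hC
      rw [hf] at this
      exact this.trans (Bool.false_le _)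
    obtain ⟨C', h3⟩ := ih (fin C r) ((w, false) ::ₘ R) h2
    refine ⟨C', ?_⟩
    rw [Multiset.replicate_succ, Multiset.replicate_succ, Multiset.cons_add, Multiset.cons_add]
    refine h1.trans ?_
    rw [Multiset.add_cons, Multiset.add_cons] at h3
    exact h3

/-- residuals of the blocked copies -/
def Mid (i : Fin 2) (r2 rest : List (LSym 2)) (x : LSub 2) : Prop :=
  ∃ u, u <:+ r2 ∧ x = (u ++ (LOp.put, i) :: rest, false)

def J (i j : Fin 2) (r2 rest : List (LSym 2)) (C : Store 2) (S : LProc 2) : Prop :=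
  C j = true ∨ ∃ u, u <:+ r2 ∧ u ≠ [] ∧ (u ++ (LOp.put, i) :: rest, false) ∈ S

theorem not_blk {C : Store 2} {a : LSym 2} {u : List (LSym 2)} {b : Bool}
    (h : ¬ Blk C (a :: u, b)) : en C a := by
  intro ha
  by_contra hc
  exact h ⟨a.2, u, by simp [← ha], by simpa using hc⟩

theorem quiesce {i j : Fin 2} (hne : i ≠ j) (r2 rest : List (LSym 2))
    (h2 : ∀ x ∈ r2, x.2 = j) (hl : ∀ a, [a] <:+ r2 → a.1 = LOp.put) (R : LProc 2) :
    ∀ (m : ℕ) (S : LProc 2) (C : Store 2), (S.map (fun x => x.1.length)).sum = m →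
      (∀ x ∈ S, Mid i r2 rest x) → C i = true →
      ∃ S' C', Reach (S + R, C) (S' + R, C') ∧ (∀ x ∈ S', Mid i r2 rest x) ∧ C' i = true ∧
        (∀ x ∈ S', Blk C' x) ∧ (J i j r2 rest C S → C' j = true) := by
  intro m
  induction m with
  | zero =>
    intro S C hm hS hC
    have : S = 0 := by
      rw [Multiset.eq_zero_iff_forall_notMem]
      intro x hx
      obtain ⟨u, _, rfl⟩ := hS x hx
      have := Multiset.sum_eq_zero_iff.1 hm _ (Multiset.mem_map_of_mem _ hx)
      simp at this
    subst this
    refine ⟨0, C, .refl, by simp, hC, by simp, ?_⟩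
    rintro (h | ⟨u, _, _, h⟩)
    · exact h
    · simp at h
  | succ m ih =>
    intro S C hm hS hC
    by_cases hb : ∀ x ∈ S, Blk C x
    · refine ⟨S, C, .refl, hS, hC, hb, ?_⟩
      rintro (h | ⟨u, hu, hu0, h⟩)
      · exact h
      · obtain ⟨k, w, hk, hk'⟩ := hb _ h
        cases u with
        | nil => exact absurd rfl hu0
        | cons a u =>
          simp only [List.cons_append, List.cons.injEq] at hk
          have := h2 a (hu.subset (by simp))
          rw [hk.1] at this
          simp only at this
          rw [← this]; exact hk'
    · push Not at hb
      obtain ⟨x, hx, hxb⟩ := hb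
      obtain ⟨u, hu, rfl⟩ := hS x hx
      cases u with
      | nil => exact absurd ⟨i, rest, rfl, hC⟩ hxb
      | cons a u =>
        have ha : a.2 = j := h2 a (hu.subset (by simp))
        obtain ⟨S1, rfl⟩ := Multiset.exists_cons_of_mem hx
        have hen : en C a := not_blk hxb
        have hu' : u <:+ r2 := (List.suffix_cons a u).trans hu
        have hstep := step_ctx C a (u ++ (LOp.put, i) :: rest) false (S1 + R) hen
        obtain ⟨S', C', g1, g2, g3, g4, g5⟩ := ih ((u ++ (LOp.put, i) :: rest, false) ::ₘ S1) (eff C a)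
          (by simp at hm ⊢; omega)
          (by
            intro x hx
            rcases Multiset.mem_cons.1 hx with rfl | hx
            · exact ⟨u, hu', rfl⟩
            · exact hS x (Multiset.mem_cons_of_mem hx))
          (by simp [eff, ha, Function.update_of_ne hne, hC])
        refine ⟨S', C', ?_, g2, g3, g4, fun _ => g5 ?_⟩
        · rw [Multiset.cons_add] at g1 ⊢
          exact .head hstep g1
        · cases u with
          | nil => left; simp [eff, ha, hl a hu]
          | cons c u => right; exact ⟨c :: u, hu', by simp, Multiset.mem_cons_self _ _⟩

/-- the quiescent states -/
def Qs (i : Fin 2) (r2 rest : List (LSym 2)) (n : ℕ) (v : List (LSym 2)) (x : LProc 2 × Store 2) : Prop :=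
  ∃ S : LProc 2, x.1 = (v, true) ::ₘ (Multiset.replicate n ((LOp.put, i) :: (r2 ++ (LOp.put, i) :: rest), false) + S) ∧
    (∀ y ∈ S, Mid i r2 rest y) ∧ x.2 i = true ∧ ∀ y ∈ S, Blk x.2 y

def Fails (x : LProc 2 × Store 2) : Prop := ∃ y, Reach x y ∧ ¬ LMayConv y

/-- refill lock `i` (if needed) and quiesce -/
theorem refill {i j : Fin 2} (hne : i ≠ j) (r2 rest : List (LSym 2))
    (h2 : ∀ x ∈ r2, x.2 = j) (hl : ∀ a, [a] <:+ r2 → a.1 = LOp.put) (n : ℕ) (v : List (LSym 2))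
    (S : LProc 2) (C : Store 2) (hS : ∀ y ∈ S, Mid i r2 rest y) :
    ∃ n' x, n ≤ n' ∧ Reach ((v, true) ::ₘ (Multiset.replicate (n+1) ((LOp.put, i) :: (r2 ++ (LOp.put, i) :: rest), false) + S), C) x ∧
      Qs i r2 rest n' v x ∧ (C j = true → x.2 j = true) := by
  by_cases hC : C i = true
  · obtain ⟨S', C', g1, g2, g3, g4, g5⟩ := quiesce hne r2 rest h2 hl
      ((v, true) ::ₘ Multiset.replicate (n+1) ((LOp.put, i) :: (r2 ++ (LOp.put, i) :: rest), false)) _ S C rfl hS hC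
    refine ⟨n+1, (S' + ((v, true) ::ₘ Multiset.replicate (n+1) ((LOp.put, i) :: (r2 ++ (LOp.put, i) :: rest), false)), C'), by omega, ?_, ⟨S', ?_, g2, g3, g4⟩, fun h => g5 (Or.inl h)⟩
    · rw [← Multiset.cons_add, add_comm]; exact g1
    · simp only; rw [add_comm, Multiset.cons_add]
  · have hC : C i = false := by simpa using hC
    have hstep := step_ctx C (LOp.put, i) (r2 ++ (LOp.put, i) :: rest) false
      ((v, true) ::ₘ (Multiset.replicate n ((LOp.put, i) :: (r2 ++ (LOp.put, i) :: rest), false) + S)) (fun _ => hC)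
    obtain ⟨S', C', g1, g2, g3, g4, g5⟩ := quiesce hne r2 rest h2 hl
      ((v, true) ::ₘ Multiset.replicate n ((LOp.put, i) :: (r2 ++ (LOp.put, i) :: rest), false)) _
      ((r2 ++ (LOp.put, i) :: rest, false) ::ₘ S) (eff C (LOp.put, i)) rfl
      (by
        intro x hx
        rcases Multiset.mem_cons.1 hx with rfl | hx
        · exact ⟨r2, List.suffix_refl _, rfl⟩
        · exact hS x hx) (by simp [eff])
    refine ⟨n, (S' + ((v, true) ::ₘ Multiset.replicate n ((LOp.put, i) :: (r2 ++ (LOp.put, i) :: rest), false)), C'), le_rfl, ?_, ⟨S', ?_, g2, g3, g4⟩, fun h => g5 (Or.inl ?_)⟩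
    · rw [Multiset.replicate_succ, Multiset.cons_add, Multiset.cons_swap]
      refine .head hstep ?_
      rw [Multiset.cons_add] at g1
      convert g1 using 4
      rw [Multiset.add_cons, add_comm]
    · simp only; rw [add_comm, Multiset.cons_add]
    · simp [eff, Function.update_of_ne hne.symm, h]

theorem tstep {i j : Fin 2} (hne : i ≠ j) (hij : ∀ k, k ≠ j ↔ k = i) (r2 rest : List (LSym 2))
    (h2 : ∀ x ∈ r2, x.2 = j) (hl : ∀ a, [a] <:+ r2 → a.1 = LOp.put) (n : ℕ) (a : LSym 2) (v : List (LSym 2))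
    (x : LProc 2 × Store 2) (hx : Qs i r2 rest (n+1) (a :: v) x) :
    (Fails x) ∨ (en x.2 a ∧ ∃ n' y, n ≤ n' ∧ Reach x y ∧ Qs i r2 rest n' v y ∧
      ((a = (LOp.put, j) ∨ (x.2 j = true ∧ a.2 ≠ j)) → y.2 j = true)) := by
  obtain ⟨M, C⟩ := x
  obtain ⟨S, h3, h4, h5, h6⟩ := hx
  simp only at h3 h5 h6
  subst h3
  by_cases hen : en C a
  · right
    refine ⟨hen, ?_⟩
    have hstep := step_ctx C a v true (Multiset.replicate (n+1) ((LOp.put, i) :: (r2 ++ (LOp.put, i) :: rest), false) + S) hen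
    obtain ⟨n', y, g1, g2, g3, g4⟩ := refill hne r2 rest h2 hl n v S (eff C a) h4
    refine ⟨n', y, g1, .head hstep g2, g3, fun h => g4 ?_⟩
    rcases h with rfl | ⟨h, h'⟩
    · simp [eff]
    · simpa [eff, Function.update_of_ne h'.symm] using h
  · left
    refine ⟨_, .refl, dead_not_may _ _ ?_⟩
    intro y hy
    simp only [Multiset.mem_cons, Multiset.mem_add] at hy
    rcases hy with rfl | hy | hy
    · by_contra hb
      exact hen (not_blk hb)
    · rw [Multiset.eq_of_mem_replicate hy]
      exact ⟨i, _, rfl, h5⟩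
    · exact h6 y hy

theorem Fails.of_reach {x y} (h : Reach x y) (hf : Fails y) : Fails x := by
  obtain ⟨z, h1, h2⟩ := hf
  exact ⟨z, h.trans h1, h2⟩

theorem claimA {i j : Fin 2} (hne : i ≠ j) (hij : ∀ k, k ≠ j ↔ k = i) (r2 rest : List (LSym 2))
    (h2 : ∀ x ∈ r2, x.2 = j) (hl : ∀ a, [a] <:+ r2 → a.1 = LOp.put) (w v : List (LSym 2)) :
    ∀ (n : ℕ) (x : LProc 2 × Store 2), (∀ y ∈ v, y.2 ≠ j) → v.length < n → x.2 j = true →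
      Qs i r2 rest n (v ++ (LOp.put, j) :: w) x → Fails x := by
  induction v with
  | nil =>
    intro n x _ hn hj hx
    obtain ⟨n, rfl⟩ := Nat.exists_eq_succ_of_ne_zero (Nat.ne_of_gt (Nat.zero_lt_of_lt hn))
    rcases tstep hne hij r2 rest h2 hl n _ _ x hx with h | ⟨h, _⟩
    · exact h
    · have := h rfl; simp [hj] at this
  | cons a v ih =>
    intro n x hv hn hj hx
    obtain ⟨n, rfl⟩ := Nat.exists_eq_succ_of_ne_zero (Nat.ne_of_gt (Nat.zero_lt_of_lt hn))
    rcases tstep hne hij r2 rest h2 hl n _ _ x hx with h | ⟨_, n', y, g1, g2, g3, g4⟩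
    · exact h
    · refine Fails.of_reach g2 (ih n' y (fun y hy => hv y (by simp [hy])) ?_ ?_ g3)
      · simp at hn; omega
      · exact g4 (Or.inr ⟨hj, hv a (by simp)⟩)

theorem claimB {i j : Fin 2} (hne : i ≠ j) (hij : ∀ k, k ≠ j ↔ k = i) (r2 rest : List (LSym 2))
    (h2 : ∀ x ∈ r2, x.2 = j) (hl : ∀ a, [a] <:+ r2 → a.1 = LOp.put) (w r4 : List (LSym 2))
    (h4 : ∀ y ∈ r4, y.2 ≠ j) (v : List (LSym 2)) :
    ∀ (n : ℕ) (x : LProc 2 × Store 2), v.length + r4.length + 1 < n →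
      Qs i r2 rest n (v ++ (LOp.put, j) :: (r4 ++ (LOp.put, j) :: w)) x → Fails x := by
  induction v with
  | nil =>
    intro n x hn hx
    obtain ⟨n, rfl⟩ := Nat.exists_eq_succ_of_ne_zero (Nat.ne_of_gt (Nat.zero_lt_of_lt hn))
    rcases tstep hne hij r2 rest h2 hl n _ _ x hx with h | ⟨_, n', y, g1, g2, g3, g4⟩
    · exact h
    · refine Fails.of_reach g2 (claimA hne hij r2 rest h2 hl w r4 n' y h4 ?_ (g4 (Or.inl rfl)) g3)
      simp at hn; omega
  | cons a v ih =>
    intro n x hn hx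
    obtain ⟨n, rfl⟩ := Nat.exists_eq_succ_of_ne_zero (Nat.ne_of_gt (Nat.zero_lt_of_lt hn))
    rcases tstep hne hij r2 rest h2 hl n _ _ x hx with h | ⟨_, n', y, g1, g2, g3, g4⟩
    · exact h
    · refine Fails.of_reach g2 (ih n' y ?_ g3)
      simp at hn; omega

theorem half {IS : Store 2} {i j : Fin 2} {s t : List (LSym 2)} (hne : i ≠ j)
    (hij : ∀ k, k ≠ j ↔ k = i)
    (H : ∀ n : ℕ, LMustConv ((t, true) ::ₘ Multiset.replicate (n+1) (s, false), IS))
    (hs : BlockingTypePP IS s i) (ht : BlockingTypePP IS t j) :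
    (∃ R1 M rest, s = R1 ++ (LOp.put, i) :: (M ++ [(LOp.take, j)]) ++ (LOp.put, i) :: rest ∧
      (∀ x ∈ M, x.2 = j) ∧ SoloBlocked IS s i rest) ∧
    (∃ pre rest, s = pre ++ (LOp.take, j) :: rest ∧ ∀ x ∈ pre, x.2 = i) := by
  have hft := part2 (H 0) ht
  constructor
  swap
  · obtain ⟨pre, rest, h1, h2⟩ := ft_ex j s hft
    exact ⟨pre, rest, h1, fun x hx => (hij _).1 (h2 x hx)⟩
  obtain ⟨r1, r2, rest, hs1, hr2, hb⟩ := hs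
  have h2 : ∀ x ∈ r2, x.2 = j := by
    intro x hx
    by_contra hc
    exact hr2 x hx ((hij _).1 hc)
  by_cases hl : ∀ a, [a] <:+ r2 → a.1 = LOp.put
  · exfalso
    obtain ⟨r3, r4, w, ht1, hr4, -⟩ := ht
    have hb' := hb
    rw [hs1] at hb'
    obtain ⟨k1, -⟩ := blocked_solo hb'
    rw [ok_append] at k1
    obtain ⟨k1, k2, -⟩ := k1
    have hnf : nf j r1 := by
      apply ft_nf j r1 ((LOp.put, i) :: (r2 ++ (LOp.put, i) :: rest))
      rw [hs1] at hft
      simpa using hft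
    obtain ⟨C, hC⟩ := park hij IS r1 ((LOp.put, i) :: (r2 ++ (LOp.put, i) :: rest)) hnf k1 (k2 rfl)
      (r3.length + r4.length + 2 + 1) IS {(t, true)} le_rfl
    obtain ⟨n', x, g1, g2, g3, -⟩ := refill hne r2 rest h2 hl (r3.length + r4.length + 2) t 0 C (by simp)
    have g3' := g3
    rw [ht1] at g3'
    simp only [List.append_assoc, List.cons_append] at g3'
    obtain ⟨y, q1, q2⟩ := claimB hne hij r2 rest h2 hl w r4 hr4 r3 n' x (by omega) g3'
    refine q2 (H (r3.length + r4.length + 2) y ?_)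
    refine Relation.ReflTransGen.trans ?_ (g2.trans q1)
    rw [add_zero]
    have hs2 : s = r1 ++ (LOp.put, i) :: (r2 ++ (LOp.put, i) :: rest) := by simp [hs1]
    rw [← hs2, add_comm, Multiset.singleton_add, add_comm _ {(t, true)}, Multiset.singleton_add] at hC
    exact hC
  · push Not at hl
    obtain ⟨a, ⟨M, rfl⟩, ha⟩ := hl
    have haj := h2 a (by simp)
    have ha' : a = (LOp.take, j) := by
      obtain ⟨o, k⟩ := a
      cases o
      · exact absurd rfl ha
      · simp at haj; rw [haj]
    subst ha'
    exact ⟨r1, M, rest, hs1, fun x hx => h2 x (by simp [hx]), hb⟩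

theorem succ_step {P Q : SProc} (h : SysStep P Q) (hs : SSuccessful P) : SSuccessful Q := by
  obtain ⟨u1, u2, b1, b2, R, rfl, rfl⟩ := h
  simp only [SSuccessful, Multiset.mem_cons, Prod.mk.injEq] at hs ⊢
  simp at hs
  simp [hs]

theorem succ_reach {P Q : SProc} (h : Relation.ReflTransGen SysStep P Q) (hs : SSuccessful P) :
    SSuccessful Q := by
  induction h with
  | refl => exact hs
  | tail _ h ih => exact succ_step h ih

theorem must_of {P Q0 : SProc} (h0 : SysStep P Q0) (h : ∀ Q, SysStep P Q → SSuccessful Q) :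
    SMustConv P := by
  intro Q hr
  rcases Relation.ReflTransGen.cases_head hr with rfl | ⟨c, hc, hr⟩
  · exact ⟨Q0, .single h0, h _ h0⟩
  · exact ⟨Q, .refl, succ_reach hr (h c hc)⟩

theorem must_ques (n : ℕ) :
    SMustConv (([SSym.ques], true) ::ₘ Multiset.replicate (n+1) ([SSym.bang], false)) := by
  refine must_of (Q0 := ([], false) ::ₘ ([], true) ::ₘ Multiset.replicate n ([SSym.bang], false))
    ⟨[], [], false, true, _, ?_, rfl⟩ ?_
  · rw [Multiset.replicate_succ, Multiset.cons_swap]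
  · rintro Q ⟨u1, u2, b1, b2, R, h1, rfl⟩
    have : (SSym.ques :: u2, b2) ∈ (([SSym.ques], true) ::ₘ Multiset.replicate (n+1) ([SSym.bang], false) : SProc) := by
      rw [h1]; simp
    simp [Multiset.mem_replicate] at this
    simp [SSuccessful, this]

theorem must_bang (n : ℕ) :
    SMustConv (([SSym.bang], true) ::ₘ Multiset.replicate (n+1) ([SSym.ques], false)) := by
  refine must_of (Q0 := ([], true) ::ₘ ([], false) ::ₘ Multiset.replicate n ([SSym.ques], false))
    ⟨[], [], true, false, _, ?_, rfl⟩ ?_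
  · rw [Multiset.replicate_succ]
  · rintro Q ⟨u1, u2, b1, b2, R, h1, rfl⟩
    have : (SSym.bang :: u1, b1) ∈ (([SSym.bang], true) ::ₘ Multiset.replicate (n+1) ([SSym.ques], false) : SProc) := by
      rw [h1]; simp
    simp [Multiset.mem_replicate] at this
    simp [SSuccessful, this]

/-- for a correct translation of blocking type `(P_1P_1, P_2P_2)`:
(1) the blocking prefix of `τ(!)` has the form `R₁ P_1 {P_2,T_2}* T_2 P_1` and
the blocking prefix of `τ(?)` the form `R₃ P_2 {P_1,T_1}* T_1 P_2`;
(2) `τ(!)` has a prefix in `{T_1,P_1}* T_2` and `τ(?)` a prefix in `{T_2,P_2}* T_1`. -/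
theorem blocking_prefix_shape_PP_PP :
    ∀ (IS : Store 2) (tb tq : List (LSym 2)),
      Correct IS tb tq →
      BlockingTypePP IS tb 0 → BlockingTypePP IS tq 1 →
      ((∃ R1 M rest,
          tb = R1 ++ (LOp.put, (0 : Fin 2)) :: (M ++ [(LOp.take, (1 : Fin 2))]) ++
                (LOp.put, (0 : Fin 2)) :: rest ∧
          (∀ x ∈ M, x.2 = (1 : Fin 2)) ∧ SoloBlocked IS tb 0 rest) ∧
       (∃ R3 M rest,
          tq = R3 ++ (LOp.put, (1 : Fin 2)) :: (M ++ [(LOp.take, (0 : Fin 2))]) ++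
                (LOp.put, (1 : Fin 2)) :: rest ∧
          (∀ x ∈ M, x.2 = (0 : Fin 2)) ∧ SoloBlocked IS tq 1 rest)) ∧
      ((∃ pre rest, tb = pre ++ (LOp.take, (1 : Fin 2)) :: rest ∧
          ∀ x ∈ pre, x.2 = (0 : Fin 2)) ∧
       (∃ pre rest, tq = pre ++ (LOp.take, (0 : Fin 2)) :: rest ∧
          ∀ x ∈ pre, x.2 = (1 : Fin 2))) := by 
  intro IS tb tq hc hb hq
  have H1 : ∀ n : ℕ, LMustConv ((tq, true) ::ₘ Multiset.replicate (n+1) (tb, false), IS) := by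
    intro n
    have := ((hc _).2).1 (must_ques n)
    simpa [transProc, transSub] using this
  have H2 : ∀ n : ℕ, LMustConv ((tb, true) ::ₘ Multiset.replicate (n+1) (tq, false), IS) := by
    intro n
    have := ((hc _).2).1 (must_bang n)
    simpa [transProc, transSub] using this
  have A := half (by decide) (by decide) H1 hb hq
  have B := half (by decide) (by decide) H2 hq hb
  exact ⟨⟨A.1, B.1⟩, A.2, B.2⟩
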